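/- The preimage under π̂ of the implicit ideal H' of R̂' equals the implicit ideal H of R̂; that is, π̂⁻¹(H') = H. -/

import Mathlib

/-!
Statement context. Let `(R, M)` be a noetherian local domain which is not a field, with field of
fractions `K`, and let `ν : K → ℝ≥0` be a (multiplicatively written) valuation which is ≤ 1 on `R`
and < 1 on `M` (i.e. `ν` is a nontrivial rank-one valuation centered at `R`).  For `γ ∈ ℝ≥0` let
`𝒫_γ = {x ∈ R | ν x ≤ γ}` and let `Φ = ν(R \ {0})`.  Then the implicit ideal
`H = ⋂_{γ ∈ Φ} 𝒫_γ·R̂` of the `M`-adic completion `R̂` of `R` is prime.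
-/

open IsLocalRing
open scoped NNReal

/-- The valuation ideal `𝒫_γ = {x ∈ R | ν (f x) ≤ γ}`, for a valuation `ν` on a ring `K`
and a ring homomorphism `f : R → K` such that `ν ∘ f` is bounded by `1` on `R`. -/
def valIdeal {R K : Type*} [CommRing R] [CommRing K] (f : R →+* K)
    (ν : Valuation K ℝ≥0) (hν : ∀ x : R, ν (f x) ≤ 1) (γ : ℝ≥0) : Ideal R where
  carrier := {x : R | ν (f x) ≤ γ}
  add_mem' := fun {a b} ha hb => by
    simp only [Set.mem_setOf_eq, map_add] at *
    exact le_trans (ν.map_add _ _) (max_le ha hb)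
  zero_mem' := by simp
  smul_mem' := fun c x hx => by
    simp only [smul_eq_mul, Set.mem_setOf_eq, map_mul] at *
    calc ν (f c) * ν (f x) ≤ 1 * γ := mul_le_mul' (hν c) hx
      _ = γ := one_mul γ

/-- The value semigroup `Φ = ν(R \ {0})`. -/
def valSemigroup {R K : Type*} [CommRing R] [CommRing K] (f : R →+* K)
    (ν : Valuation K ℝ≥0) : Set ℝ≥0 :=
  {γ : ℝ≥0 | ∃ x : R, x ≠ 0 ∧ ν (f x) = γ}

/-- The implicit ideal `H = ⋂_{γ ∈ Φ} 𝒫_γ·R̂` of the `M`-adic completion `R̂` of a local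
ring `R`. -/
noncomputable def implicitIdeal {R K : Type*} [CommRing R] [IsLocalRing R] [CommRing K]
    (f : R →+* K) (ν : Valuation K ℝ≥0) (hν : ∀ x : R, ν (f x) ≤ 1) :
    Ideal (AdicCompletion (maximalIdeal R) R) :=
  ⨅ γ ∈ valSemigroup f ν,
    Ideal.map (algebraMap R (AdicCompletion (maximalIdeal R) R)) (valIdeal f ν hν γ)

/-- If `π(M) ⊆ M'` then `M^n ≤ (M'^n).comap π`. -/
theorem pow_le_comap_pow {R R' : Type*} [CommRing R] [CommRing R'] {M : Ideal R} {M' : Ideal R'}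
    (π : R →+* R') (h : ∀ x ∈ M, π x ∈ M') (n : ℕ) : M ^ n ≤ (M' ^ n).comap π := by
  rw [← Ideal.map_le_iff_le_comap, Ideal.map_pow]
  exact Ideal.pow_right_mono (Ideal.map_le_iff_le_comap.mpr h) n

/-- `πhat : R̂ → R̂'` is *the* ring homomorphism induced on the `M`-adic (resp. `M'`-adic)
completions by a local homomorphism `π : R → R'`: it is characterized by its compatibility
with the canonical projections `R̂ → R/Mⁿ`, `R̂' → R'/M'ⁿ` and the homomorphisms
`R/Mⁿ → R'/M'ⁿ` induced by `π` (such a compatible homomorphism is unique, because an element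
of an adic completion is determined by its images in all the quotients). -/
def IsInducedCompletionHom {R R' : Type*} [CommRing R] [CommRing R']
    [IsLocalRing R] [IsLocalRing R']
    (π : R →+* R') (hπ : ∀ x ∈ maximalIdeal R, π x ∈ maximalIdeal R')
    (πhat : AdicCompletion (maximalIdeal R) R →+* AdicCompletion (maximalIdeal R') R') : Prop :=
  ∀ (n : ℕ) (x : AdicCompletion (maximalIdeal R) R),
    AdicCompletion.evalₐ (maximalIdeal R') n (πhat x) =
      Ideal.quotientMap ((maximalIdeal R') ^ n) π (pow_le_comap_pow π hπ n)
        (AdicCompletion.evalₐ (maximalIdeal R) n x)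

theorem mem_valIdeal {R K : Type*} [CommRing R] [CommRing K] {f : R →+* K}
    {ν : Valuation K ℝ≥0} {hν : ∀ x : R, ν (f x) ≤ 1} {γ : ℝ≥0} {x : R} :
    x ∈ valIdeal f ν hν γ ↔ ν (f x) ≤ γ :=
  Iff.rfl

/-- If `ν < 1` on a finitely generated ideal `I`, then every valuation ideal of positive level
contains a power of `I`. -/
theorem exists_pow_le_valIdeal {R K : Type*} [CommRing R] [CommRing K] {f : R →+* K}
    {ν : Valuation K ℝ≥0} (hν : ∀ x : R, ν (f x) ≤ 1) {I : Ideal R} (hI : I.FG)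
    (hlt : ∀ x ∈ I, ν (f x) < 1) {γ : ℝ≥0} (hγ : 0 < γ) :
    ∃ n : ℕ, I ^ n ≤ valIdeal f ν hν γ := by
  refine Ideal.exists_pow_le_of_le_radical_of_fg (fun x hx => ?_) hI
  obtain ⟨n, hn⟩ := exists_pow_lt_of_lt_one hγ (hlt x hx)
  exact ⟨n, by simpa [mem_valIdeal] using hn.le⟩

/-- If `I` is finitely generated and `I ^ n ≤ J`, then membership in the extension of `J` to the
`I`-adic completion can be tested modulo `I ^ n`. -/
theorem AdicCompletion.mem_map_algebraMap_iff {R : Type*} [CommRing R] {I J : Ideal R}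
    (hI : I.FG) {n : ℕ} (hJ : I ^ n ≤ J) {x : AdicCompletion I R} {a : R}
    (hx : AdicCompletion.evalₐ I n x = Ideal.Quotient.mk (I ^ n) a) :
    x ∈ J.map (algebraMap R (AdicCompletion I R)) ↔ a ∈ J := by
  constructor
  · intro h
    have h' := Ideal.mem_map_of_mem (AdicCompletion.evalₐ I n : AdicCompletion I R →+* R ⧸ I ^ n) h
    rw [Ideal.map_map, AlgHom.comp_algebraMap, RingHom.coe_coe, hx,
      Ideal.Quotient.algebraMap_eq] at h'
    exact (Ideal.mem_quotient_iff_mem hJ).mp h'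
  · intro h
    have hker : x - algebraMap R (AdicCompletion I R) a ∈ (AdicCompletion.eval I R n).ker := by
      rw [LinearMap.mem_ker, ← AdicCompletion.factor_evalₐ_eq_eval I _ (Ideal.mul_top _).ge,
        map_sub, hx, AlgHom.commutes, Ideal.Quotient.algebraMap_eq, sub_self, _root_.map_zero]
    rw [← AdicCompletion.pow_smul_top_eq_ker_eval hI, Ideal.smul_top_eq_map] at hker
    rw [← sub_add_cancel x (algebraMap R (AdicCompletion I R) a)]
    exact add_mem (Ideal.map_mono hJ hker) (Ideal.mem_map_of_mem _ h)

/-- The homomorphism induced on completions pulls back the extension of `J'` to the extension of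
`J'.comap π`, for every ideal `J'` containing a power of the maximal ideal. -/
theorem IsInducedCompletionHom.mem_map_iff {R R' : Type*} [CommRing R] [CommRing R']
    [IsNoetherianRing R] [IsNoetherianRing R'] [IsLocalRing R] [IsLocalRing R']
    {π : R →+* R'} {hπ : ∀ x ∈ maximalIdeal R, π x ∈ maximalIdeal R'}
    {πhat : AdicCompletion (maximalIdeal R) R →+* AdicCompletion (maximalIdeal R') R'}
    (h : IsInducedCompletionHom π hπ πhat) {J' : Ideal R'} {n : ℕ}
    (hJ' : maximalIdeal R' ^ n ≤ J') (x : AdicCompletion (maximalIdeal R) R) :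
    πhat x ∈ J'.map (algebraMap R' (AdicCompletion (maximalIdeal R') R')) ↔
      x ∈ (J'.comap π).map (algebraMap R (AdicCompletion (maximalIdeal R) R)) := by
  obtain ⟨a, ha⟩ := Ideal.Quotient.mk_surjective (AdicCompletion.evalₐ (maximalIdeal R) n x)
  have ha' : AdicCompletion.evalₐ (maximalIdeal R') n (πhat x) = Ideal.Quotient.mk _ (π a) := by
    rw [h n x, ← ha, Ideal.quotientMap_mk]
  rw [AdicCompletion.mem_map_algebraMap_iff (IsNoetherian.noetherian _) hJ' ha',
    AdicCompletion.mem_map_algebraMap_iff (IsNoetherian.noetherian _)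
      ((pow_le_comap_pow π hπ n).trans (Ideal.comap_mono hJ')) ha.symm, Ideal.mem_comap]

/-- The preimage under `π̂ : R̂ → R̂'` of the implicit ideal `H'` of `R̂'`
equals the implicit ideal `H` of `R̂`.  Here `ν := ν' ∘ π` is the induced valuation on `R`,
`H = ⋂_{γ ∈ Φ} 𝒫_γ·R̂`, `H' = ⋂_{γ ∈ Φ'} 𝒫'_γ·R̂'`, and `π̂` is the homomorphism of adic
completions induced by the local homomorphism `π : R → R'`. -/
theorem comap_inducedCompletionHom_implicitIdeal
    (R R' : Type*) [CommRing R] [CommRing R'] [IsDomain R] [IsDomain R']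
    [IsNoetherianRing R] [IsNoetherianRing R'] [IsLocalRing R] [IsLocalRing R']
    (hR : ¬ IsField R) (hR' : ¬ IsField R')
    (π : R →+* R') (hinj : Function.Injective π)
    (hloc : ∀ x ∈ maximalIdeal R, π x ∈ maximalIdeal R')
    (ν' : Valuation (FractionRing R') ℝ≥0)
    (hν'1 : ∀ x : R', ν' (algebraMap R' (FractionRing R') x) ≤ 1)
    (hν'2 : ∀ x ∈ maximalIdeal R', ν' (algebraMap R' (FractionRing R') x) < 1)
    (πhat : AdicCompletion (maximalIdeal R) R →+* AdicCompletion (maximalIdeal R') R')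
    (hπhat : IsInducedCompletionHom π hloc πhat) :
    Ideal.comap πhat (implicitIdeal (algebraMap R' (FractionRing R')) ν' hν'1) =
      implicitIdeal ((algebraMap R' (FractionRing R')).comp π) ν'
        (fun x => hν'1 (π x)) := by
  have hpos : ∀ x : R', x ≠ 0 → 0 < ν' (algebraMap R' (FractionRing R') x) := fun x hx => by
    rw [pos_iff_ne_zero, ν'.ne_zero_iff]
    simpa using hx
  have key : ∀ γ : ℝ≥0, 0 < γ → ∀ x,
      πhat x ∈ (valIdeal _ ν' hν'1 γ).map
        (algebraMap R' (AdicCompletion (maximalIdeal R') R')) ↔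
      x ∈ (valIdeal ((algebraMap R' (FractionRing R')).comp π) ν' (fun x => hν'1 (π x)) γ).map
        (algebraMap R (AdicCompletion (maximalIdeal R) R)) := fun γ hγ x => by
    obtain ⟨n, hn⟩ := exists_pow_le_valIdeal hν'1 (IsNoetherian.noetherian _) hν'2 hγ
    exact hπhat.mem_map_iff hn x
  have hπ0 : ∀ {x : R}, x ≠ 0 → π x ≠ 0 := (map_ne_zero_iff π hinj).mpr
  ext x
  simp only [implicitIdeal, Ideal.mem_comap, Submodule.mem_iInf]
  constructor
  · rintro h _ ⟨y, hy, rfl⟩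
    exact (key _ (hpos _ (hπ0 hy)) x).mp (h _ ⟨π y, hπ0 hy, rfl⟩)
  · rintro h _ ⟨y, hy, rfl⟩
    obtain ⟨m, hm, hm0⟩ := Submodule.exists_mem_ne_zero_of_ne_bot
      (mt IsLocalRing.isField_iff_maximalIdeal_eq.mpr hR)
    obtain ⟨n, hn⟩ := exists_pow_lt_of_lt_one (hpos y hy) (hν'2 _ (hloc m hm))
    refine (key _ (hpos y hy) x).mpr
      (Ideal.map_mono (fun z hz => ?_) (h _ ⟨m ^ n, pow_ne_zero n hm0, rfl⟩))
    rw [mem_valIdeal] at hz ⊢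
    exact hz.trans (by simpa using hn.le)
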